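/- Let M = (M_j)_{j≥0} be a strongly regular sequence and let γ be a real number with 0 < γ < γ(M) and γ < 2. Then there exist a holomorphic, nowhere vanishing function G on the sector S_γ = {z ∈ ℂ \ {0} : |Arg z| < γπ/2} and positive constants κ₁, κ₂, b₁₃, b₁₄, b₁₅, b₁₆, b₁₇, depending only on M and γ, such that for every z ∈ S_γ: (a) κ₁ · h_M(κ₂|z|) ≤ |G(z)|; (b) |G^{(j)}(z)| ≤ b₁₃^j j! M_j · h_M(b₁₄|z|) for every j ∈ ℕ; and (c) |(1/G)^{(j)}(z)| ≤ b₁₅ b₁₆^j j! M_j · (h_M(b₁₇|z|))^{-1} for every j ∈ ℕ. -/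

import Mathlib

noncomputable section

open Filter MeasureTheory
open scoped Topology

def StronglyRegularWith (M : ℕ → ℝ) (A : ℝ) : Prop :=
  (∀ j, 0 < M j) ∧ M 0 = 1 ∧ Monotone M ∧
  (∀ j : ℕ, M (j + 1) * M (j + 1) ≤ M j * M (j + 2)) ∧
  1 ≤ A ∧
  (∀ j k : ℕ, M (j + k) ≤ A ^ (j + k) * (M j * M k)) ∧
  (∀ ℓ N : ℕ, ∑ j ∈ Finset.range N,
      M (ℓ + j) / (((ℓ + j : ℕ) + 1 : ℝ) * M (ℓ + j + 1)) ≤ A * (M ℓ / M (ℓ + 1)))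

def StronglyRegular (M : ℕ → ℝ) : Prop := ∃ A : ℝ, StronglyRegularWith M A

noncomputable def hfn (M : ℕ → ℝ) (t : ℝ) : ℝ :=
  if t = 0 then 0 else ⨅ j : ℕ, t ^ j * M j

def PropertyP (M : ℕ → ℝ) (γ : ℝ) : Prop :=
  ∃ (m' : ℕ → ℝ) (a : ℝ), 1 ≤ a ∧ (∀ j, 0 < m' j) ∧
    (Monotone fun j : ℕ => ((j : ℝ) + 1) ^ (-γ) * m' j) ∧
    (∀ j : ℕ, a⁻¹ * (M (j + 1) / M j) ≤ m' j ∧ m' j ≤ a * (M (j + 1) / M j))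

noncomputable def growthIndex (M : ℕ → ℝ) : ℝ :=
  sSup {γ : ℝ | 0 < γ ∧ PropertyP M γ}

def Sector (γ : ℝ) : Set ℂ :=
  {z : ℂ | z ≠ 0 ∧ |Complex.arg z| < γ * Real.pi / 2}

noncomputable def mixedPartial {n : ℕ} {F : Type*} [NormedAddCommGroup F] [NormedSpace ℝ F]
    (S : Set (EuclideanSpace ℝ (Fin n))) (f : EuclideanSpace ℝ (Fin n) → F)
    (k : ℕ) (e : Fin k → Fin n) (x : EuclideanSpace ℝ (Fin n)) : F :=
  iteratedFDerivWithin ℝ k f S x fun i => EuclideanSpace.single (e i) 1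

lemma rpow_neg_succ_le_telescope {p x : ℝ} (hp : 1 < p) (hx : 1 ≤ x) :
    x ^ (-p) ≤ 2 ^ p / (p - 1) * (x ^ (1 - p) - (x + 1) ^ (1 - p)) := by
  have hx0 : 0 < x := by linarith
  have hp1 : 0 < p - 1 := by linarith
  have hlog : Real.log x - Real.log (x + 1) ≤ -(1 / (x + 1)) := by
    rw [← Real.log_div (by positivity) (by positivity)]
    refine (Real.log_le_sub_one_of_pos (by positivity)).trans (le_of_eq ?_)
    field_simp
    ring
  have hquot : (x + 1) ^ (1 - p) * (1 + (p - 1) / (x + 1)) ≤ x ^ (1 - p) := by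
    rw [Real.rpow_def_of_pos hx0, Real.rpow_def_of_pos (by positivity : 0 < x + 1)]
    have h1 : 1 + (p - 1) / (x + 1) ≤ Real.exp ((p - 1) / (x + 1)) := by
      linarith [Real.add_one_le_exp ((p - 1) / (x + 1))]
    refine (mul_le_mul_of_nonneg_left h1 (Real.exp_pos _).le).trans ?_
    rw [← Real.exp_add]
    apply Real.exp_le_exp.mpr
    have h2 := mul_le_mul_of_nonneg_right hlog hp1.le
    have h3 : (p - 1) / (x + 1) = 1 / (x + 1) * (p - 1) := by ring
    rw [h3]
    nlinarith
  have hdiff : (p - 1) * (x + 1) ^ (-p) ≤ x ^ (1 - p) - (x + 1) ^ (1 - p) := by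
    have h4 : (x + 1) ^ (1 - p) = (x + 1) ^ (-p) * (x + 1) := by
      rw [← Real.rpow_add_one (by positivity)]
      ring_nf
    have h5 : (x + 1) ^ (1 - p) * ((p - 1) / (x + 1)) = (p - 1) * (x + 1) ^ (-p) := by
      rw [h4]
      field_simp
    nlinarith
  have hdouble : x ^ (-p) ≤ 2 ^ p * (x + 1) ^ (-p) := by
    have h6 : (2 * x) ^ (-p) ≤ (x + 1) ^ (-p) :=
      Real.rpow_le_rpow_of_nonpos (by positivity) (by linarith) (by linarith)
    rw [Real.mul_rpow (by norm_num) hx0.le, Real.rpow_neg (by norm_num : (0 : ℝ) ≤ 2)] at h6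
    have h2p : (0 : ℝ) < 2 ^ p := by positivity
    calc x ^ (-p) = 2 ^ p * ((2 ^ p)⁻¹ * x ^ (-p)) := by field_simp
      _ ≤ _ := by gcongr
  calc x ^ (-p) ≤ 2 ^ p * (x + 1) ^ (-p) := hdouble
    _ = 2 ^ p / (p - 1) * ((p - 1) * (x + 1) ^ (-p)) := by field_simp
    _ ≤ _ := by gcongr

lemma sum_rpow_neg_tail_le {p : ℝ} (hp : 1 < p) (n N : ℕ) :
    ∑ k ∈ Finset.range N, (((n + k : ℕ) : ℝ) + 1) ^ (-p) ≤
      2 ^ p / (p - 1) * ((n : ℝ) + 1) ^ (1 - p) := by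
  have hp1 : 0 < p - 1 := by linarith
  have hsum : ∑ k ∈ Finset.range N, (((n + k : ℕ) : ℝ) + 1) ^ (-p) ≤
      ∑ k ∈ Finset.range N, (2 ^ p / (p - 1) * (((n + k : ℕ) : ℝ) + 1) ^ (1 - p) -
        2 ^ p / (p - 1) * (((n + (k + 1) : ℕ) : ℝ) + 1) ^ (1 - p)) := by
    refine Finset.sum_le_sum fun k _ => ?_
    have h := rpow_neg_succ_le_telescope hp
      (by linarith [Nat.cast_nonneg (α := ℝ) (n + k)] : (1 : ℝ) ≤ ((n + k : ℕ) : ℝ) + 1)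
    refine h.trans (le_of_eq ?_)
    push_cast
    ring_nf
  refine hsum.trans ?_
  rw [Finset.sum_range_sub' (fun k => 2 ^ p / (p - 1) * (((n + k : ℕ) : ℝ) + 1) ^ (1 - p))]
  have : 0 ≤ 2 ^ p / (p - 1) * (((n + N : ℕ) : ℝ) + 1) ^ (1 - p) := by positivity
  simpa using this

/-- Property `(P_γ)` forces geometric-type control of the tails of a negative power of the
quotients. -/
lemma exists_tail_bound_of_propertyP {M : ℕ → ℝ} (hpos : ∀ j, 0 < M j) {γ δ : ℝ} (hδ : 0 < δ)
    (hδγ : δ < γ) (hP : PropertyP M γ) :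
    ∃ K : ℝ, 0 < K ∧ ∀ n N : ℕ,
      ∑ k ∈ Finset.range N, Real.exp (-(Real.log (M (n + k + 1)) - Real.log (M (n + k))) / δ) ≤
        Real.exp (-(Real.log (M (n + 1)) - Real.log (M n)) / δ) * (K * (n + 1)) := by
  obtain ⟨m', a, ha, hm', hmono, hcomp⟩ := hP
  have ha0 : 0 < a := by linarith
  have hp : 1 < γ / δ := (one_lt_div hδ).mpr hδγ
  have hp1 : 0 < γ / δ - 1 := by linarith
  have hlogM : ∀ j, Real.log (M (j + 1)) - Real.log (M j) = Real.log (M (j + 1) / M j) := fun j =>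
    (Real.log_div (hpos _).ne' (hpos _).ne').symm
  have hratio : ∀ n k : ℕ,
      Real.log (M (n + 1) / M n) + γ * (Real.log (((n + k : ℕ) : ℝ) + 1) - Real.log ((n : ℝ) + 1))
        - 2 * Real.log a ≤ Real.log (M (n + k + 1) / M (n + k)) := by
    intro n k
    have hn : (0 : ℝ) < (n : ℝ) + 1 := by positivity
    have hnk : (0 : ℝ) < ((n + k : ℕ) : ℝ) + 1 := by positivity
    have h1 := Real.log_le_log (mul_pos (Real.rpow_pos_of_pos hn _) (hm' n))
      (hmono (Nat.le_add_right n k))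
    rw [Real.log_mul (Real.rpow_pos_of_pos hn _).ne' (hm' _).ne',
      Real.log_mul (Real.rpow_pos_of_pos hnk _).ne' (hm' _).ne',
      Real.log_rpow hn, Real.log_rpow hnk] at h1
    have hq : ∀ j, 0 < M (j + 1) / M j := fun j => div_pos (hpos _) (hpos _)
    have h2 := Real.log_le_log (mul_pos (inv_pos.mpr ha0) (hq n)) (hcomp n).1
    rw [Real.log_mul (inv_pos.mpr ha0).ne' (hq n).ne', Real.log_inv] at h2
    have h3 := Real.log_le_log (hm' (n + k)) (hcomp (n + k)).2
    rw [Real.log_mul ha0.ne' (hq (n + k)).ne'] at h3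
    nlinarith
  refine ⟨Real.exp (2 * Real.log a / δ) * (2 ^ (γ / δ) / (γ / δ - 1)), by positivity,
    fun n N => ?_⟩
  have hn : (0 : ℝ) < (n : ℝ) + 1 := by positivity
  set r := Real.exp (-(Real.log (M (n + 1)) - Real.log (M n)) / δ) with hr
  have hterm : ∀ k ∈ Finset.range N,
      Real.exp (-(Real.log (M (n + k + 1)) - Real.log (M (n + k))) / δ) ≤
        r * Real.exp (2 * Real.log a / δ) * ((n : ℝ) + 1) ^ (γ / δ) *
          (((n + k : ℕ) : ℝ) + 1) ^ (-(γ / δ)) := by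
    intro k _
    have hnk : (0 : ℝ) < ((n + k : ℕ) : ℝ) + 1 := by positivity
    rw [hr, Real.rpow_def_of_pos hn, Real.rpow_def_of_pos hnk, ← Real.exp_add, ← Real.exp_add,
      ← Real.exp_add, hlogM, hlogM]
    apply Real.exp_le_exp.mpr
    have h := div_le_div_of_nonneg_right (hratio n k) hδ.le
    refine le_of_sub_nonneg ((sub_nonneg.mpr h).trans (le_of_eq ?_))
    field_simp
    ring
  refine (Finset.sum_le_sum hterm).trans ?_
  rw [← Finset.mul_sum]
  refine (mul_le_mul_of_nonneg_left (sum_rpow_neg_tail_le hp n N) (by positivity)).trans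
    (le_of_eq ?_)
  have hpow : ((n : ℝ) + 1) ^ (γ / δ) * ((n : ℝ) + 1) ^ (1 - γ / δ) = (n : ℝ) + 1 := by
    rw [← Real.rpow_add hn]
    simp
  calc _ = r * Real.exp (2 * Real.log a / δ) * (2 ^ (γ / δ) / (γ / δ - 1)) *
        (((n : ℝ) + 1) ^ (γ / δ) * ((n : ℝ) + 1) ^ (1 - γ / δ)) := by ring
    _ = _ := by rw [hpow]; ring

lemma norm_log_one_add_le_of_re_nonneg {w : ℂ} (hw : 0 ≤ w.re) :
    ‖Complex.log (1 + w)‖ ≤ ‖w‖ := by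
  have hder : ∀ x ∈ {x : ℂ | 0 ≤ x.re},
      HasDerivAt (fun x => Complex.log (1 + x)) (1 / (1 + x)) x := by
    intro x hx
    have hslit : 1 + x ∈ Complex.slitPlane := by
      left
      have : (0 : ℝ) ≤ x.re := hx
      simp only [Complex.add_re, Complex.one_re]
      linarith
    exact ((hasDerivAt_id x).const_add 1).clog hslit
  have h := Convex.norm_image_sub_le_of_norm_deriv_le (C := 1)
    (fun x hx => (hder x hx).differentiableAt)
    (fun x hx => by
      rw [(hder x hx).deriv, norm_div, norm_one]
      have h1 : (0 : ℝ) ≤ x.re := hx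
      have h2 : 1 ≤ ‖1 + x‖ := by
        refine le_trans ?_ (Complex.re_le_norm _)
        simpa using h1
      exact (div_le_one (by linarith)).mpr h2)
    (convex_halfSpace_re_ge 0) (by simp : (0 : ℂ) ∈ {x : ℂ | 0 ≤ x.re})
    (by simpa using hw : w ∈ {x : ℂ | 0 ≤ x.re})
  simpa using h

/-- The logarithm of a canonical product with summable coefficients is holomorphic in the right
half plane. -/
lemma differentiableOn_tsum_log_one_add {ρ : ℕ → ℝ} (hρ : ∀ j, 0 < ρ j) (hs : Summable ρ) :
    DifferentiableOn ℂ (fun ζ : ℂ => ∑' j, Complex.log (1 + ρ j * ζ)) {ζ | 0 < ζ.re} := by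
  have hopen : IsOpen {ζ : ℂ | 0 < ζ.re} := isOpen_lt continuous_const Complex.continuous_re
  intro ζ₀ hζ₀
  have hU : IsOpen ({ζ : ℂ | 0 < ζ.re} ∩ Metric.ball 0 (‖ζ₀‖ + 1)) := hopen.inter Metric.isOpen_ball
  have hre : ∀ (j : ℕ) (ζ : ℂ), 0 < ζ.re → 0 < ((ρ j : ℂ) * ζ).re := by
    intro j ζ hζ
    rw [Complex.re_ofReal_mul]
    exact mul_pos (hρ j) hζ
  have hd : DifferentiableOn ℂ (fun ζ : ℂ => ∑' j, Complex.log (1 + ρ j * ζ))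
      ({ζ : ℂ | 0 < ζ.re} ∩ Metric.ball 0 (‖ζ₀‖ + 1)) := by
    refine Complex.differentiableOn_tsum_of_summable_norm (hs.mul_right (‖ζ₀‖ + 1)) ?_ hU ?_
    · intro j ζ hζ
      refine DifferentiableAt.differentiableWithinAt ?_
      refine DifferentiableAt.clog (by fun_prop) (Or.inl ?_)
      have := hre j ζ hζ.1
      simp only [Complex.add_re, Complex.one_re]
      linarith
    · intro j ζ hζ
      refine (norm_log_one_add_le_of_re_nonneg (hre j ζ hζ.1).le).trans ?_
      rw [norm_mul, Complex.norm_real, Real.norm_of_nonneg (hρ j).le]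
      exact mul_le_mul_of_nonneg_left (mem_ball_zero_iff.mp hζ.2).le (hρ j).le
  exact (hd.differentiableAt (hU.mem_nhds ⟨hζ₀, by simp⟩)).differentiableWithinAt

lemma re_exp_neg_log_div_pos {δ : ℝ} (hδ : 0 < δ) {z : ℂ} (hz : z ∈ Sector δ) :
    0 < (Complex.exp (-Complex.log z / δ)).re := by
  rw [Complex.exp_re]
  refine mul_pos (Real.exp_pos _) (Real.cos_pos_of_mem_Ioo ?_)
  have him : (-Complex.log z / (δ : ℂ)).im = -z.arg / δ := by
    rw [Complex.div_ofReal_im, Complex.neg_im, Complex.log_im]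
  obtain ⟨h1, h2⟩ := abs_lt.mp hz.2
  rw [him]
  constructor
  · rw [lt_div_iff₀ hδ]; linarith
  · rw [div_lt_iff₀ hδ]; linarith

lemma norm_exp_neg_log_div (δ : ℝ) (z : ℂ) :
    ‖Complex.exp (-Complex.log z / δ)‖ = Real.exp (-Real.log ‖z‖ / δ) := by
  rw [Complex.norm_exp, Complex.div_ofReal_re, Complex.neg_re, Complex.log_re]

lemma sector_subset_slitPlane {δ : ℝ} (hδ : δ < 2) : Sector δ ⊆ Complex.slitPlane := by
  intro z hz
  rw [Complex.mem_slitPlane_iff_arg]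
  refine ⟨fun h => ?_, hz.1⟩
  have := hz.2
  rw [h, abs_of_pos Real.pi_pos] at this
  nlinarith [Real.pi_pos]

lemma isOpen_sector {δ : ℝ} (hδ : δ < 2) : IsOpen (Sector δ) := by
  rw [isOpen_iff_mem_nhds]
  intro z hz
  have hc : ContinuousAt (fun w : ℂ => |w.arg|) z :=
    (Complex.continuousAt_arg (sector_subset_slitPlane hδ hz)).abs
  exact inter_mem (isOpen_ne.mem_nhds hz.1) (hc.eventually_lt continuousAt_const hz.2)

lemma closedBall_subset_sector {γ δ ε : ℝ} (hδ : δ < 2) (hε0 : 0 < ε) (hε : ε ≤ 1 / 2)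
    (hε' : 3 / 2 * ε ≤ (δ - γ) * Real.pi / 2) {z : ℂ} (hz : z ∈ Sector γ) :
    Metric.closedBall z (ε * ‖z‖) ⊆ Sector δ := by
  intro w hw
  have hz0 : 0 < ‖z‖ := norm_pos_iff.mpr hz.1
  have hu : ‖(w - z) / z‖ ≤ ε := by
    rw [norm_div, div_le_iff₀ hz0]
    simpa [dist_eq_norm] using hw
  set u := (w - z) / z with hudef
  have hwz : w = z * (1 + u) := by
    rw [hudef]
    field_simp [hz.1]
    ring
  have hu1 : 1 + u ≠ 0 := by
    intro h
    have : u = -1 := by linear_combination h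
    rw [this] at hu
    norm_num at hu
    linarith
  have harg : |(1 + u).arg| ≤ 3 / 2 * ε := by
    rw [← Complex.log_im]
    refine (Complex.abs_im_le_norm _).trans ?_
    refine (Complex.norm_log_one_add_half_le_self (hu.trans hε)).trans ?_
    gcongr
  have h2 : |z.arg + (1 + u).arg| < δ * Real.pi / 2 := by
    have := abs_add_le z.arg (1 + u).arg
    have := hz.2
    linarith
  have h3 : |z.arg + (1 + u).arg| < Real.pi := by nlinarith [Real.pi_pos]
  have h4 := abs_lt.mp h3
  refine ⟨by rw [hwz]; exact mul_ne_zero hz.1 hu1, ?_⟩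
  rw [hwz, Complex.arg_mul hz.1 hu1 ⟨h4.1, h4.2.le⟩]
  exact h2

lemma bddBelow_range_pow_mul {M : ℕ → ℝ} (hpos : ∀ j, 0 < M j) {t : ℝ} (ht : 0 ≤ t) :
    BddBelow (Set.range fun j : ℕ => t ^ j * M j) :=
  ⟨0, by rintro _ ⟨j, rfl⟩; exact mul_nonneg (pow_nonneg ht j) (hpos j).le⟩

lemma hfn_le {M : ℕ → ℝ} (hpos : ∀ j, 0 < M j) {t : ℝ} (ht : 0 < t) (j : ℕ) :
    hfn M t ≤ t ^ j * M j := by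
  rw [hfn, if_neg ht.ne']
  exact ciInf_le (bddBelow_range_pow_mul hpos ht.le) j

lemma le_hfn {M : ℕ → ℝ} {t c : ℝ} (ht : 0 < t) (h : ∀ j : ℕ, c ≤ t ^ j * M j) :
    c ≤ hfn M t := by
  rw [hfn, if_neg ht.ne']
  exact le_ciInf h

lemma hfn_mono {M : ℕ → ℝ} (hpos : ∀ j, 0 < M j) {s t : ℝ} (hs : 0 < s) (hst : s ≤ t) :
    hfn M s ≤ hfn M t :=
  le_hfn (hs.trans_le hst) fun j => (hfn_le hpos hs j).trans <|
    mul_le_mul_of_nonneg_right (pow_le_pow_left₀ hs.le hst j) (hpos j).le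

lemma hfn_le_mul_hfn {M : ℕ → ℝ} (hpos : ∀ j, 0 < M j) {A : ℝ} (hA : 1 ≤ A)
    (hmg : ∀ j k : ℕ, M (j + k) ≤ A ^ (j + k) * (M j * M k)) {t : ℝ} (ht : 0 < t) (j : ℕ) :
    hfn M t ≤ (A * t) ^ j * M j * hfn M (A * t) := by
  have hAt : 0 < A * t := mul_pos (by linarith) ht
  have hj : 0 < (A * t) ^ j * M j := mul_pos (pow_pos hAt j) (hpos j)
  rw [mul_comm, ← div_le_iff₀ hj]
  refine le_hfn hAt fun k => ?_
  rw [div_le_iff₀ hj]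
  calc hfn M t ≤ t ^ (j + k) * M (j + k) := hfn_le hpos ht _
    _ ≤ t ^ (j + k) * (A ^ (j + k) * (M j * M k)) := by gcongr; exact hmg j k
    _ = _ := by rw [mul_pow, mul_pow]; ring

/-- A zero-free holomorphic function on a sector which is comparable to `h_M`, obtained as an
infinite product. -/
lemma exists_flat_function {M : ℕ → ℝ} (hpos : ∀ j, 0 < M j) (h0 : M 0 = 1) {γ δ : ℝ}
    (hδ : 0 < δ) (hδ2 : δ < 2) (hδγ : δ < γ) (hP : PropertyP M γ) :
    ∃ (G : ℂ → ℂ) (κ₁ κ₂ : ℝ), 0 < κ₁ ∧ 0 < κ₂ ∧ DifferentiableOn ℂ G (Sector δ) ∧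
      (∀ z, G z ≠ 0) ∧ (∀ z ∈ Sector δ, κ₁ * hfn M (κ₂ * ‖z‖) ≤ ‖G z‖) ∧
      (∀ z ∈ Sector δ, ‖G z‖ ≤ hfn M ‖z‖) := by
  obtain ⟨K, hK, htail⟩ := exists_tail_bound_of_propertyP hpos hδ hδγ hP
  set L : ℕ → ℝ := fun j => Real.log (M (j + 1)) - Real.log (M j) with hL
  set ρ : ℕ → ℝ := fun j => Real.exp (-L j / δ) with hρdef
  have htail' : ∀ n N : ℕ, ∑ k ∈ Finset.range N, ρ (n + k) ≤ ρ n * (K * (n + 1)) := htail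
  have hρ : ∀ j, 0 < ρ j := fun j => Real.exp_pos _
  have hs : Summable ρ := by
    refine summable_of_sum_range_le (fun j => (hρ j).le) (c := ρ 0 * (K * ((0 : ℕ) + 1)))
      fun N => ?_
    simpa using htail' 0 N
  have hsumL : ∀ n, ∑ j ∈ Finset.range n, L j = Real.log (M n) := by
    intro n
    rw [hL, Finset.sum_range_sub (fun j => Real.log (M j)), h0, Real.log_one, sub_zero]
  set E : ℂ → ℂ := fun z => Complex.exp (-Complex.log z / δ) with hE
  set F : ℂ → ℂ := fun ζ => ∑' j, Complex.log (1 + ρ j * ζ) with hF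
  have hw : ∀ (j : ℕ) (z : ℂ), ‖(ρ j : ℂ) * E z‖ = Real.exp (-(Real.log ‖z‖ + L j) / δ) := by
    intro j z
    rw [norm_mul, Complex.norm_real, Real.norm_of_nonneg (hρ j).le, hE, norm_exp_neg_log_div,
      hρdef, ← Real.exp_add]
    ring_nf
  have hre : ∀ (j : ℕ), ∀ z ∈ Sector δ, 0 < ((ρ j : ℂ) * E z).re := by
    intro j z hz
    rw [Complex.re_ofReal_mul]
    exact mul_pos (hρ j) (re_exp_neg_log_div_pos hδ hz)
  have hsw : ∀ z, Summable fun j => ‖(ρ j : ℂ) * E z‖ := by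
    intro z
    have : (fun j => ‖(ρ j : ℂ) * E z‖) = fun j => ρ j * ‖E z‖ := by
      funext j
      rw [norm_mul, Complex.norm_real, Real.norm_of_nonneg (hρ j).le]
    rw [this]
    exact hs.mul_right _
  have hslog : ∀ z ∈ Sector δ, Summable fun j => Complex.log (1 + ρ j * E z) := fun z hz =>
    Summable.of_norm_bounded (hsw z)
      fun j => norm_log_one_add_le_of_re_nonneg (hre j z hz).le
  have hsre : ∀ z ∈ Sector δ, Summable fun j => Real.log ‖1 + ρ j * E z‖ := by
    intro z hz
    simpa only [Complex.log_re] using (Complex.hasSum_re (hslog z hz).hasSum).summable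
  have hone : ∀ (j : ℕ), ∀ z ∈ Sector δ, 1 ≤ ‖1 + ρ j * E z‖ := by
    intro j z hz
    refine le_trans ?_ (Complex.re_le_norm _)
    have := hre j z hz
    rw [Complex.add_re, Complex.one_re]
    linarith
  have hself : ∀ (j : ℕ), ∀ z ∈ Sector δ, ‖(ρ j : ℂ) * E z‖ ≤ ‖1 + ρ j * E z‖ := by
    intro j z hz
    have h := hre j z hz
    rw [Complex.norm_def, Complex.norm_def]
    apply Real.sqrt_le_sqrt
    rw [Complex.normSq_apply, Complex.normSq_apply, Complex.add_re, Complex.add_im,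
      Complex.one_re, Complex.one_im]
    nlinarith
  have hGnorm : ∀ z ∈ Sector δ, ‖Complex.exp (-δ * F (E z))‖ =
      Real.exp (-(δ * ∑' j, Real.log ‖1 + ρ j * E z‖)) := by
    intro z hz
    have h : (F (E z)).re = ∑' j, Real.log ‖1 + ρ j * E z‖ := by
      rw [hF, Complex.re_tsum (hslog z hz)]
      simp only [Complex.log_re]
    rw [Complex.norm_exp, ← h, ← Complex.ofReal_neg, Complex.re_ofReal_mul]
    ring_nf
  refine ⟨fun z => Complex.exp (-δ * F (E z)), Real.exp (-(δ * K)),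
    Real.exp (-(δ * (Real.log 2 + K))), Real.exp_pos _, Real.exp_pos _, ?_,
    fun z => Complex.exp_ne_zero _, ?_, ?_⟩
  · have hEd : DifferentiableOn ℂ E (Sector δ) := by
      intro z hz
      have := sector_subset_slitPlane hδ2 hz
      exact (((Complex.differentiableAt_log this).neg.div_const _).cexp).differentiableWithinAt
    have hFE := (differentiableOn_tsum_log_one_add hρ hs).comp hEd
      fun z hz => re_exp_neg_log_div_pos hδ hz
    exact (hFE.const_mul (-(δ : ℂ))).cexp
  · intro z hz
    have hz0 : 0 < ‖z‖ := norm_pos_iff.mpr hz.1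
    have hlarge : ∃ n, 0 ≤ Real.log ‖z‖ + L n := by
      by_contra! hcon
      have hlim := (hs.tendsto_atTop_zero).eventually
        (gt_mem_nhds (Real.exp_pos (Real.log ‖z‖ / δ)))
      obtain ⟨n, hn⟩ := hlim.exists
      have h1 := (Real.exp_lt_exp).mp hn
      have h2 := (div_lt_div_iff_of_pos_right hδ).mp h1
      linarith [hcon n]
    classical
    set n := Nat.find hlarge with hndef
    have hn : 0 ≤ Real.log ‖z‖ + L n := Nat.find_spec hlarge
    have hlt : ∀ j < n, Real.log ‖z‖ + L j < 0 := fun j hj => not_le.mp (Nat.find_min hlarge hj)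
    have hup : ∀ j, Real.log ‖1 + ρ j * E z‖ ≤ Real.log (1 + ‖(ρ j : ℂ) * E z‖) := by
      intro j
      refine Real.log_le_log (by linarith [hone j z hz]) ?_
      simpa using norm_add_le (1 : ℂ) (ρ j * E z)
    have hhead : ∑ j ∈ Finset.range n, Real.log ‖1 + ρ j * E z‖ ≤
        -(n * Real.log ‖z‖ + Real.log (M n)) / δ + n * Real.log 2 := by
      have hj : ∀ j ∈ Finset.range n, Real.log ‖1 + ρ j * E z‖ ≤
          -(Real.log ‖z‖ + L j) / δ + Real.log 2 := by
        intro j hj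
        refine (hup j).trans ?_
        rw [hw]
        have hx : 0 ≤ -(Real.log ‖z‖ + L j) / δ :=
          div_nonneg (by linarith [hlt j (Finset.mem_range.mp hj)]) hδ.le
        have hx1 := Real.one_le_exp hx
        rw [← Real.log_exp (-(Real.log ‖z‖ + L j) / δ),
          ← Real.log_mul (Real.exp_pos _).ne' (by norm_num), Real.log_exp]
        exact Real.log_le_log (by positivity) (by linarith)
      refine (Finset.sum_le_sum hj).trans (le_of_eq ?_)
      rw [Finset.sum_add_distrib, ← Finset.sum_div, Finset.sum_neg_distrib, Finset.sum_add_distrib,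
        hsumL]
      simp
    have htl : ∑' k, Real.log ‖1 + ρ (k + n) * E z‖ ≤ K * (n + 1) := by
      refine Real.tsum_le_of_sum_range_le (fun k => Real.log_nonneg (hone _ z hz)) fun N => ?_
      have hk : ∀ k ∈ Finset.range N, Real.log ‖1 + ρ (k + n) * E z‖ ≤ ρ (n + k) * ‖E z‖ := by
        intro k _
        refine (hup _).trans ?_
        have := Real.log_le_sub_one_of_pos
          (by positivity : 0 < 1 + ‖(ρ (k + n) : ℂ) * E z‖)
        rw [add_sub_cancel_left] at this
        refine this.trans (le_of_eq ?_)
        rw [norm_mul, Complex.norm_real, Real.norm_of_nonneg (hρ _).le, add_comm k n]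
      refine (Finset.sum_le_sum hk).trans ?_
      rw [← Finset.sum_mul]
      have h1 : ρ n * ‖E z‖ ≤ 1 := by
        have h2 := hw n z
        rw [norm_mul, Complex.norm_real, Real.norm_of_nonneg (hρ _).le] at h2
        rw [h2, Real.exp_le_one_iff]
        exact div_nonpos_of_nonpos_of_nonneg (by linarith) hδ.le
      calc _ ≤ ρ n * (K * (n + 1)) * ‖E z‖ := by gcongr; exact htail' n N
        _ = ρ n * ‖E z‖ * (K * (n + 1)) := by ring
        _ ≤ 1 * (K * (n + 1)) := by gcongr
        _ = _ := one_mul _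
    have htot : δ * ∑' j, Real.log ‖1 + ρ j * E z‖ ≤
        -(n * Real.log ‖z‖ + Real.log (M n)) + δ * (n * Real.log 2 + K * (n + 1)) := by
      rw [← (hsre z hz).sum_add_tsum_nat_add n]
      calc _ ≤ δ * (-(n * Real.log ‖z‖ + Real.log (M n)) / δ + n * Real.log 2 + K * (n + 1)) := by
            gcongr
        _ = _ := by field_simp; ring
    rw [hGnorm z hz]
    set κ := Real.exp (-(δ * (Real.log 2 + K))) with hκ
    have hκ0 : 0 < κ := Real.exp_pos _
    refine (mul_le_mul_of_nonneg_left (hfn_le hpos (mul_pos hκ0 hz0) n)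
      (Real.exp_pos _).le).trans ?_
    have hfac : Real.exp (-(δ * K)) * ((κ * ‖z‖) ^ n * M n) =
        Real.exp (-(δ * K) + (n * (-(δ * (Real.log 2 + K)) + Real.log ‖z‖) + Real.log (M n))) := by
      rw [Real.exp_add, Real.exp_add, Real.exp_nat_mul, Real.exp_add, Real.exp_log hz0,
        Real.exp_log (hpos n)]
    rw [hfac]
    apply Real.exp_le_exp.mpr
    linarith
  · intro z hz
    have hz0 : 0 < ‖z‖ := norm_pos_iff.mpr hz.1
    refine le_hfn hz0 fun n => ?_
    rw [hGnorm z hz]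
    have h1 : ∑ j ∈ Finset.range n, -(Real.log ‖z‖ + L j) / δ ≤
        ∑' j, Real.log ‖1 + ρ j * E z‖ := by
      refine le_trans (Finset.sum_le_sum fun j _ => ?_)
        ((hsre z hz).sum_le_tsum (Finset.range n) fun j _ => Real.log_nonneg (hone j z hz))
      rw [← Real.log_exp (-(Real.log ‖z‖ + L j) / δ), ← hw j z]
      refine Real.log_le_log ?_ (hself j z hz)
      rw [hw]
      exact Real.exp_pos _
    rw [← Finset.sum_div, Finset.sum_neg_distrib, Finset.sum_add_distrib, hsumL,
      div_le_iff₀ hδ] at h1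
    have hfac : ‖z‖ ^ n * M n = Real.exp (n * Real.log ‖z‖ + Real.log (M n)) := by
      rw [Real.exp_add, Real.exp_nat_mul, Real.exp_log hz0, Real.exp_log (hpos n)]
    rw [hfac]
    apply Real.exp_le_exp.mpr
    simp only [Finset.sum_const, Finset.card_range, nsmul_eq_mul] at h1
    linarith

/-- Cauchy's estimates for functions holomorphic in a wider sector. -/
lemma norm_iteratedDerivWithin_sector_le {γ δ ε : ℝ} (hγ : γ < 2) (hδ : δ < 2) (hε0 : 0 < ε)
    (hε : ε ≤ 1 / 2) (hε' : 3 / 2 * ε ≤ (δ - γ) * Real.pi / 2) {f : ℂ → ℂ}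
    (hf : DifferentiableOn ℂ f (Sector δ)) {z : ℂ} (hz : z ∈ Sector γ) {C : ℝ}
    (hC : ∀ w ∈ Sector δ, ‖z‖ / 2 ≤ ‖w‖ → ‖w‖ ≤ 2 * ‖z‖ → ‖f w‖ ≤ C) (j : ℕ) :
    ‖iteratedDerivWithin j f (Sector γ) z‖ ≤ (Nat.factorial j : ℝ) * C / (ε * ‖z‖) ^ j := by
  have hz0 : 0 < ‖z‖ := norm_pos_iff.mpr hz.1
  have hsub := closedBall_subset_sector hδ hε0 hε hε' hz
  rw [iteratedDerivWithin_of_isOpen (isOpen_sector hγ) hz]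
  refine Complex.norm_iteratedDeriv_le_of_forall_mem_sphere_norm_le j (mul_pos hε0 hz0)
    ((hf.mono hsub).diffContOnCl_ball Set.Subset.rfl) fun w hw => ?_
  have hd : ‖w - z‖ = ε * ‖z‖ := by simpa [dist_eq_norm] using hw
  have h1 : ε * ‖z‖ ≤ 1 / 2 * ‖z‖ := by gcongr
  have h2 : ‖w‖ ≤ ‖w - z‖ + ‖z‖ := by simpa using norm_add_le (w - z) z
  have h3 : ‖z‖ ≤ ‖w‖ + ‖w - z‖ := by
    simpa [norm_sub_rev] using norm_add_le w (z - w)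
  exact hC w (hsub (Metric.sphere_subset_closedBall hw)) (by linarith) (by linarith)

/-- for strongly regular `M` and `0 < γ < min(γ(M), 2)` there exist a
holomorphic nowhere-vanishing function `G` on `S_γ` and positive constants
`κ₁, κ₂, b₁₃, b₁₄, b₁₅, b₁₆, b₁₇` (depending only on `M` and `γ`) such that on `S_γ`:
(a) `κ₁ h_M(κ₂|z|) ≤ |G(z)|`; (b) `|G^{(j)}(z)| ≤ b₁₃^j j! M_j h_M(b₁₄|z|)`;
(c) `|(1/G)^{(j)}(z)| ≤ b₁₅ b₁₆^j j! M_j (h_M(b₁₇|z|))⁻¹`. -/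
theorem stmt14 (M : ℕ → ℝ) (hM : StronglyRegular M) (γ : ℝ)
    (hγ0 : 0 < γ) (hγM : γ < growthIndex M) (hγ2 : γ < 2) :
    ∃ (G : ℂ → ℂ) (κ₁ κ₂ b₁₃ b₁₄ b₁₅ b₁₆ b₁₇ : ℝ),
      0 < κ₁ ∧ 0 < κ₂ ∧ 0 < b₁₃ ∧ 0 < b₁₄ ∧ 0 < b₁₅ ∧ 0 < b₁₆ ∧ 0 < b₁₇ ∧
      DifferentiableOn ℂ G (Sector γ) ∧
      (∀ z ∈ Sector γ, G z ≠ 0) ∧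
      (∀ z ∈ Sector γ, κ₁ * hfn M (κ₂ * ‖z‖) ≤ ‖G z‖) ∧
      (∀ (j : ℕ), ∀ z ∈ Sector γ,
        ‖iteratedDerivWithin j G (Sector γ) z‖ ≤
          b₁₃ ^ j * (Nat.factorial j : ℝ) * M j * hfn M (b₁₄ * ‖z‖)) ∧
      (∀ (j : ℕ), ∀ z ∈ Sector γ,
        ‖iteratedDerivWithin j (fun w => (G w)⁻¹) (Sector γ) z‖ ≤
          b₁₅ * b₁₆ ^ j * (Nat.factorial j : ℝ) * M j * (hfn M (b₁₇ * ‖z‖))⁻¹) := by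
  obtain ⟨A, hpos, h0, -, -, hA, hmg, -⟩ := hM
  have hne : {g : ℝ | 0 < g ∧ PropertyP M g}.Nonempty := by
    by_contra hcon
    rw [Set.not_nonempty_iff_eq_empty] at hcon
    rw [growthIndex, hcon, Real.sSup_empty] at hγM
    linarith
  obtain ⟨γ', ⟨-, hP⟩, hγγ'⟩ := exists_lt_of_lt_csSup hne hγM
  obtain ⟨δ, hγδ, hδmin⟩ := exists_between (lt_min hγγ' hγ2)
  have hδ2 : δ < 2 := hδmin.trans_le (min_le_right _ _)
  obtain ⟨G, κ₁, κ₂, hκ₁, hκ₂, hGd, hG0, hlow, hupp⟩ :=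
    exists_flat_function hpos h0 (hγ0.trans hγδ) hδ2 (hδmin.trans_le (min_le_left _ _)) hP
  have hA0 : 0 < A := by linarith
  obtain ⟨ε, hε0, hε, hε'⟩ : ∃ ε : ℝ, 0 < ε ∧ ε ≤ 1 / 2 ∧
      3 / 2 * ε ≤ (δ - γ) * Real.pi / 2 := by
    have hpos' : 0 < (δ - γ) * Real.pi / 3 := by
      have := mul_pos (sub_pos.mpr hγδ) Real.pi_pos
      linarith
    refine ⟨min (1 / 2) ((δ - γ) * Real.pi / 3), lt_min (by norm_num) hpos', min_le_left _ _, ?_⟩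
    linarith [min_le_right (1 / 2) ((δ - γ) * Real.pi / 3)]
  have hsub : Sector γ ⊆ Sector δ := fun z hz => ⟨hz.1, hz.2.trans (by gcongr)⟩
  have hhpos : ∀ t : ℝ, 0 < t → 0 < hfn M t := by
    intro t ht
    have hmem : (t : ℂ) ∈ Sector δ := by
      refine ⟨by exact_mod_cast ht.ne', ?_⟩
      rw [Complex.arg_ofReal_of_nonneg ht.le, abs_zero]
      have := mul_pos (hγ0.trans hγδ) Real.pi_pos
      linarith
    have h := hupp t hmem
    rw [Complex.norm_real, Real.norm_of_nonneg ht.le] at h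
    exact (norm_pos_iff.mpr (hG0 t)).trans_le h
  refine ⟨G, κ₁, κ₂, 2 * A / ε, 2 * A, κ₁⁻¹, κ₂ / 2 / ε, κ₂ / (2 * A), hκ₁, hκ₂, by positivity,
    by positivity, by positivity, by positivity, by positivity, hGd.mono hsub,
    fun z _ => hG0 z, fun z hz => hlow z (hsub hz), ?_, ?_⟩
  · intro j z hz
    have hz0 : 0 < ‖z‖ := norm_pos_iff.mpr hz.1
    refine (norm_iteratedDerivWithin_sector_le hγ2 hδ2 hε0 hε hε' hGd hz (C := hfn M (2 * ‖z‖))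
      (fun w hw _ h2 => (hupp w hw).trans
        (hfn_mono hpos (norm_pos_iff.mpr hw.1) h2)) j).trans ?_
    have h := hfn_le_mul_hfn hpos hA hmg (by positivity : 0 < 2 * ‖z‖) j
    calc _ ≤ (Nat.factorial j : ℝ) *
          ((A * (2 * ‖z‖)) ^ j * M j * hfn M (A * (2 * ‖z‖))) / (ε * ‖z‖) ^ j := by gcongr
      _ = (A * (2 * ‖z‖) / (ε * ‖z‖)) ^ j * (Nat.factorial j : ℝ) * M j *
          hfn M (A * (2 * ‖z‖)) := by rw [div_pow]; ring
      _ = _ := by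
        rw [show A * (2 * ‖z‖) / (ε * ‖z‖) = 2 * A / ε by field_simp,
          show A * (2 * ‖z‖) = 2 * A * ‖z‖ by ring]
  · intro j z hz
    have hz0 : 0 < ‖z‖ := norm_pos_iff.mpr hz.1
    have hinv : DifferentiableOn ℂ (fun w => (G w)⁻¹) (Sector δ) := hGd.fun_inv fun w _ => hG0 w
    have hh1 := hhpos (κ₂ * (‖z‖ / 2)) (by positivity)
    have hh2 := hhpos (κ₂ / (2 * A) * ‖z‖) (by positivity)
    refine (norm_iteratedDerivWithin_sector_le hγ2 hδ2 hε0 hε hε' hinv hz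
      (C := κ₁⁻¹ * (hfn M (κ₂ * (‖z‖ / 2)))⁻¹) (fun w hw h1 _ => ?_) j).trans ?_
    · rw [norm_inv, ← mul_inv]
      refine inv_anti₀ (mul_pos hκ₁ hh1) (le_trans ?_ (hlow w hw))
      gcongr
      exact hfn_mono hpos (by positivity) (by gcongr)
    · have h := hfn_le_mul_hfn hpos hA hmg (by positivity : 0 < κ₂ / (2 * A) * ‖z‖) j
      rw [show A * (κ₂ / (2 * A) * ‖z‖) = κ₂ * (‖z‖ / 2) by field_simp] at h
      have h' : (hfn M (κ₂ * (‖z‖ / 2)))⁻¹ ≤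
          (κ₂ * (‖z‖ / 2)) ^ j * M j * (hfn M (κ₂ / (2 * A) * ‖z‖))⁻¹ := by
        rw [← div_eq_mul_inv, le_div_iff₀ hh2, inv_mul_le_iff₀ hh1]
        linarith
      calc _ ≤ (Nat.factorial j : ℝ) * (κ₁⁻¹ *
            ((κ₂ * (‖z‖ / 2)) ^ j * M j * (hfn M (κ₂ / (2 * A) * ‖z‖))⁻¹)) / (ε * ‖z‖) ^ j := by
              gcongr
        _ = κ₁⁻¹ * (κ₂ * (‖z‖ / 2) / (ε * ‖z‖)) ^ j * (Nat.factorial j : ℝ) * M j *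
            (hfn M (κ₂ / (2 * A) * ‖z‖))⁻¹ := by rw [div_pow]; ring
        _ = _ := by
          rw [show κ₂ * (‖z‖ / 2) / (ε * ‖z‖) = κ₂ / 2 / ε by field_simp]
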